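/- For every matroid N in ℰ₃, if M is a simple binary matroid containing none of I₃, F₇, or N as an induced restriction, then χ(M) ≤ dim(N) + 4. -/

import Mathlib

/-- A simple binary matroid `M = (E, G)`: a dimension `n` together with a ground set `E`
of nonzero vectors of `𝔽₂ⁿ` (the points of `G = 𝔽₂ⁿ \ {0}`). -/
structure BinMatroid where
  dim : ℕ
  E : Set (Fin dim → ZMod 2)
  zero_not_mem : 0 ∉ E

namespace BinMatroid

/-- `M.HasIR N` : `M` contains `N` as an induced restriction, i.e. there is an injective
linear map `φ` with `φ(E(N)) = E(M) ∩ (φ(G') \ {0})`. -/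
def HasIR (M N : BinMatroid) : Prop :=
  ∃ φ : (Fin N.dim → ZMod 2) →ₗ[ZMod 2] (Fin M.dim → ZMod 2),
    Function.Injective φ ∧ φ '' N.E = M.E ∩ (Set.range φ \ {0})

/-- Isomorphism of binary matroids: a bijective induced embedding. -/
def Iso (M N : BinMatroid) : Prop :=
  ∃ φ : (Fin N.dim → ZMod 2) →ₗ[ZMod 2] (Fin M.dim → ZMod 2),
    Function.Bijective φ ∧ φ '' N.E = M.E ∩ (Set.range φ \ {0})

/-- The critical number of the induced restriction of the ground set `E` to the flat of
the subspace `F`: the least `k` such that some flat of `F` of dimension `dim F - k`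
is disjoint from `E`. -/
noncomputable def critNumRes {n : ℕ} (E : Set (Fin n → ZMod 2))
    (F : Submodule (ZMod 2) (Fin n → ZMod 2)) : ℕ :=
  sInf {k : ℕ | ∃ W : Submodule (ZMod 2) (Fin n → ZMod 2), W ≤ F ∧
    Module.finrank (ZMod 2) W = Module.finrank (ZMod 2) F - k ∧
    Disjoint ((W : Set (Fin n → ZMod 2)) \ {0}) E}

/-- The critical number `χ(M)`: the least `k ≥ 0` such that some flat of dimension
`n - k` is disjoint from `E`. -/
noncomputable def critNum (M : BinMatroid) : ℕ :=
  sInf {k : ℕ | ∃ W : Submodule (ZMod 2) (Fin M.dim → ZMod 2),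
    Module.finrank (ZMod 2) W = M.dim - k ∧
    Disjoint ((W : Set (Fin M.dim → ZMod 2)) \ {0}) M.E}

/-- `M ∈ ℰ_k` : every induced restriction of `M` to a flat of dimension at least `k`
has even size. -/
def MemE (k : ℕ) (M : BinMatroid) : Prop :=
  ∀ W : Submodule (ZMod 2) (Fin M.dim → ZMod 2),
    k ≤ Module.finrank (ZMod 2) W →
    Even (M.E ∩ ((W : Set (Fin M.dim → ZMod 2)) \ {0})).ncard

/-- `M` is full-rank: `E` spans `𝔽₂ⁿ`. -/
def FullRank (M : BinMatroid) : Prop :=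
  Submodule.span (ZMod 2) M.E = ⊤

/-- `M` is (isomorphic to) the doubling of `M₀`: `M₀` is identified, via an injective
linear map `φ`, with the restriction of `M` to a hyperplane `H = range φ`, there is
`w ∈ G − (E ∪ H)`, and `E = (E ∩ H) ∪ (w + (E ∩ H))`. -/
def IsDoublingOf (M M₀ : BinMatroid) : Prop :=
  M.dim = M₀.dim + 1 ∧
  ∃ φ : (Fin M₀.dim → ZMod 2) →ₗ[ZMod 2] (Fin M.dim → ZMod 2),
    Function.Injective φ ∧
    ∃ w : Fin M.dim → ZMod 2, w ≠ 0 ∧ w ∉ Set.range φ ∧ w ∉ M.E ∧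
      M.E = φ '' M₀.E ∪ (fun x => w + x) '' (φ '' M₀.E)

/-- `M` arises from `M₀` by a (possibly empty) sequence of doublings. -/
def ArisesByDoublings (M M₀ : BinMatroid) : Prop :=
  ∃ M' : BinMatroid,
    Relation.ReflTransGen (fun A B => IsDoublingOf B A) M₀ M' ∧ M.Iso M'

/-- `M` is (a copy of) `AG°(t−1, 2)`, the matroid `((G − H) ∪ {x}, G)` with `H` a
hyperplane of `G` and `x ∈ H`, where `t = M.dim`. -/
def IsAGo (M : BinMatroid) : Prop :=
  ∃ H : Submodule (ZMod 2) (Fin M.dim → ZMod 2),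
    Module.finrank (ZMod 2) H + 1 = M.dim ∧
    ∃ x ∈ (H : Set (Fin M.dim → ZMod 2)) \ {0},
      M.E = ({v | v ≠ 0} \ (H : Set (Fin M.dim → ZMod 2))) ∪ {x}

/-- `M` is a Bose–Burton geometry of order `k`: `E = G − F` for a flat `F` of
dimension `n − k`. -/
def IsBoseBurton (M : BinMatroid) (k : ℕ) : Prop :=
  k ≤ M.dim ∧ ∃ W : Submodule (ZMod 2) (Fin M.dim → ZMod 2),
    Module.finrank (ZMod 2) W = M.dim - k ∧
    M.E = {v | v ≠ 0} \ (W : Set (Fin M.dim → ZMod 2))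

/-- The ground set `E` (of a matroid of the ambient dimension `n`) is the semidoubling
of its restriction to the hyperplane `H₁` with respect to the hyperplane `H₀` of `H₁`:
there is `w ∈ G − (E ∪ H₁)` with `|{x, x+w} ∩ E| ∈ {0, 2}` for every `x ∈ H₀` and
`|{x, x+w} ∩ E| = 1` for every `x ∈ H₁ − H₀`. -/
def IsSemidoublingWrt {n : ℕ} (E : Set (Fin n → ZMod 2))
    (H₁ H₀ : Submodule (ZMod 2) (Fin n → ZMod 2)) : Prop :=
  H₀ ≤ H₁ ∧ Module.finrank (ZMod 2) H₀ + 1 = Module.finrank (ZMod 2) H₁ ∧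
  ∃ w : Fin n → ZMod 2, w ≠ 0 ∧ w ∉ H₁ ∧ w ∉ E ∧
    (∀ x ∈ (H₀ : Set (Fin n → ZMod 2)) \ {0},
      (({x, x + w} : Set (Fin n → ZMod 2)) ∩ E).ncard = 0 ∨
      (({x, x + w} : Set (Fin n → ZMod 2)) ∩ E).ncard = 2) ∧
    (∀ x ∈ (H₁ : Set (Fin n → ZMod 2)) \ (H₀ : Set (Fin n → ZMod 2)),
      (({x, x + w} : Set (Fin n → ZMod 2)) ∩ E).ncard = 1)

/-- The ground set `E` is a semidoubling of its restriction to the hyperplane `H₁`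
(with respect to some hyperplane `H₀` of `H₁`). -/
def IsSemidoublingOfRes {n : ℕ} (E : Set (Fin n → ZMod 2))
    (H₁ : Submodule (ZMod 2) (Fin n → ZMod 2)) : Prop :=
  ∃ H₀ : Submodule (ZMod 2) (Fin n → ZMod 2), IsSemidoublingWrt E H₁ H₀

/-- `M` is (isomorphic to) a semidoubling of `M₀`: `M₀` is identified, via an injective
linear map `φ`, with the restriction of `M` to the hyperplane `range φ`, and `M` is a
semidoubling of that restriction. -/
def IsSemidoublingOf (M M₀ : BinMatroid) : Prop :=
  M.dim = M₀.dim + 1 ∧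
  ∃ φ : (Fin M₀.dim → ZMod 2) →ₗ[ZMod 2] (Fin M.dim → ZMod 2),
    Function.Injective φ ∧
    φ '' M₀.E = M.E ∩ (Set.range φ \ {0}) ∧
    IsSemidoublingOfRes M.E (LinearMap.range φ)

/-- `M` arises from `M₀` by a (possibly empty) sequence of semidoublings. -/
def ArisesBySemidoublings (M M₀ : BinMatroid) : Prop :=
  ∃ M' : BinMatroid,
    Relation.ReflTransGen (fun A B => IsSemidoublingOf B A) M₀ M' ∧ M.Iso M'

end BinMatroid

/-- A triangle of `G`: a set `{x, y, z}` of three distinct nonzero vectors with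
`x + y + z = 0`. -/
def IsTriangle {n : ℕ} (T : Set (Fin n → ZMod 2)) : Prop :=
  ∃ x y z : Fin n → ZMod 2, x ≠ 0 ∧ y ≠ 0 ∧ z ≠ 0 ∧
    x ≠ y ∧ x ≠ z ∧ y ≠ z ∧ x + y + z = 0 ∧ T = {x, y, z}

/-- `I₃`, the claw: the 3-dimensional matroid whose ground set is the three standard
basis vectors of `𝔽₂³`. -/
def I3 : BinMatroid where
  dim := 3
  E := Set.range fun i : Fin 3 => (Pi.single i 1 : Fin 3 → ZMod 2)
  zero_not_mem := by
    rintro ⟨i, hi⟩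
    have := congrFun hi i
    simp [Pi.single_eq_same] at this

/-- `F₇`, the Fano plane: the 3-dimensional matroid whose ground set is all of
`𝔽₂³ \ {0}`. -/
def F7 : BinMatroid where
  dim := 3
  E := {v | v ≠ 0}
  zero_not_mem := by simp

/-- `K₅`: the 4-dimensional matroid whose ground set is the set of vectors of Hamming
weight 1 or 2 in `𝔽₂⁴`. -/
def K5 : BinMatroid where
  dim := 4
  E := {v | hammingNorm v = 1 ∨ hammingNorm v = 2}
  zero_not_mem := by
    intro h
    simp only [Set.mem_setOf_eq, hammingNorm_zero] at h
    omega

section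
variable {V : Type*} [AddCommGroup V] [Module (ZMod 2) V]

/-- `E` avoids claws. -/
def ClawFree (E : Set V) : Prop := ∀ a b c, a ∈ E → b ∈ E → c ∈ E → a ≠ b → a ≠ c → b ≠ c →
  a + b ∉ E → a + c ∉ E → b + c ∉ E → a + b + c ∉ E → False

/-- `E` avoids Fano planes. -/
def FanoFree (E : Set V) : Prop := ∀ a b c, a ∈ E → b ∈ E → c ∈ E →
  a + b ∈ E → a + c ∈ E → b + c ∈ E → a + b + c ∈ E → False

/-- `E` avoids planes with five points. -/
def FiveFree (E : Set V) : Prop := ∀ u v p, u ∉ E → v ∉ E → u + v ∈ E → p ∈ E → p + u ∈ E →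
  p + v ∈ E → p + (u + v) ∈ E → False

theorem c2 (x : V) : x + x = 0 := ZModModule.add_self x

theorem c2' (x y : V) : x + (x + y) = y := by rw [← add_assoc, c2, zero_add]

theorem hasIR_of (M N : BinMatroid) (φ : (Fin N.dim → ZMod 2) →ₗ[ZMod 2] (Fin M.dim → ZMod 2))
    (hi : Function.Injective φ) (h : ∀ x, φ x ∈ M.E ↔ x ∈ N.E) : M.HasIR N := by
  refine ⟨φ, hi, ?_⟩
  ext y
  constructor
  · rintro ⟨x, hx, rfl⟩
    refine ⟨(h x).2 hx, ⟨x, rfl⟩, ?_⟩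
    intro h0
    have := (h x).2 hx
    rw [Set.mem_singleton_iff.1 h0] at this
    exact M.zero_not_mem this
  · rintro ⟨hy, ⟨x, rfl⟩, -⟩
    exact ⟨x, (h x).1 hy, rfl⟩

/-- The linear map sending the standard basis to `a, b, c`. -/
noncomputable def map3 (a b c : V) : (Fin 3 → ZMod 2) →ₗ[ZMod 2] V :=
  Fintype.linearCombination (ZMod 2) ![a, b, c]

theorem map3_apply (a b c : V) (x : Fin 3 → ZMod 2) :
    map3 a b c x = x 0 • a + x 1 • b + x 2 • c := by
  simp [map3, Fintype.linearCombination_apply, Fin.sum_univ_three]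

theorem forall_vec3 (p : (Fin 3 → ZMod 2) → Prop) (h : ∀ i j k : ZMod 2, p ![i, j, k]) (x) :
    p x := by
  have : x = ![x 0, x 1, x 2] := by ext i; fin_cases i <;> rfl
  rw [this]; exact h _ _ _

theorem zmod2_cases (i : ZMod 2) : i = 0 ∨ i = 1 := by revert i; decide

theorem map3_inj (a b c : V) (h1 : a ≠ 0) (h2 : b ≠ 0) (h3 : c ≠ 0) (h4 : a + b ≠ 0)
    (h5 : a + c ≠ 0) (h6 : b + c ≠ 0) (h7 : a + b + c ≠ 0) :
    Function.Injective (map3 a b c) := by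
  rw [injective_iff_map_eq_zero]
  refine forall_vec3 _ ?_
  intro i j k
  rw [map3_apply]
  rcases zmod2_cases i with rfl | rfl <;> rcases zmod2_cases j with rfl | rfl <;>
    rcases zmod2_cases k with rfl | rfl <;> simp_all

theorem clawFree_of (M : BinMatroid) (h : ¬ M.HasIR I3) : ClawFree M.E := by
  intro a b c ha hb hc hab hac hbc n1 n2 n3 n4
  have hz := M.zero_not_mem
  have e : ∀ x y : Fin M.dim → ZMod 2, x + y = 0 → x = y := fun x y h => by
    have := c2' x y; rw [h, add_zero] at this; exact this
  apply h
  refine hasIR_of M I3 (map3 a b c) (map3_inj a b c ?_ ?_ ?_ ?_ ?_ ?_ ?_) ?_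
  · rintro rfl; exact hz ha
  · rintro rfl; exact hz hb
  · rintro rfl; exact hz hc
  · exact fun h => hab (e _ _ h)
  · exact fun h => hac (e _ _ h)
  · exact fun h => hbc (e _ _ h)
  · intro h; rw [e _ _ h] at n1; exact n1 hc
  · refine forall_vec3 _ ?_
    have key : ∀ i j k : ZMod 2, (![i, j, k] ∈ I3.E ↔ (i, j, k) = (1, 0, 0) ∨ (i, j, k) = (0, 1, 0) ∨ (i, j, k) = (0, 0, 1)) := by
      change ∀ i j k : ZMod 2, ((∃ l : Fin 3, (Pi.single l 1 : Fin 3 → ZMod 2) = ![i, j, k]) ↔ _)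
      decide
    intro i j k
    refine Iff.trans ?_ (key i j k).symm
    change map3 a b c (![i, j, k] : Fin 3 → ZMod 2) ∈ M.E ↔ _
    rw [map3_apply]
    rcases zmod2_cases i with rfl | rfl <;> rcases zmod2_cases j with rfl | rfl <;>
      rcases zmod2_cases k with rfl | rfl <;>
      simp [ha, hb, hc, n1, n2, n3, n4, hz]

theorem fanoFree_of (M : BinMatroid) (h : ¬ M.HasIR F7) : FanoFree M.E := by
  intro a b c ha hb hc n1 n2 n3 n4
  have hz := M.zero_not_mem
  have e : ∀ x, x ∈ M.E → x ≠ 0 := by rintro x hx rfl; exact hz hx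
  apply h
  refine hasIR_of M F7 (map3 a b c) (map3_inj a b c (e _ ha) (e _ hb) (e _ hc) (e _ n1) (e _ n2) (e _ n3) (e _ n4)) ?_
  · refine forall_vec3 _ ?_
    have key : ∀ i j k : ZMod 2, (![i, j, k] ∈ F7.E ↔ ¬ (i, j, k) = (0, 0, 0)) := by
      change ∀ i j k : ZMod 2, ((![i, j, k] : Fin 3 → ZMod 2) ≠ 0 ↔ _)
      decide
    intro i j k
    refine Iff.trans ?_ (key i j k).symm
    change map3 a b c (![i, j, k] : Fin 3 → ZMod 2) ∈ M.E ↔ _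
    rw [map3_apply]
    rcases zmod2_cases i with rfl | rfl <;> rcases zmod2_cases j with rfl | rfl <;>
      rcases zmod2_cases k with rfl | rfl <;>
      simp [ha, hb, hc, n1, n2, n3, n4, hz]

theorem critNum_le (M : BinMatroid) (W : Submodule (ZMod 2) (Fin M.dim → ZMod 2)) (k : ℕ)
    (hW : ∀ x ∈ W, x ∉ M.E) (hk : M.dim ≤ Module.finrank (ZMod 2) W + k) : M.critNum ≤ k := by
  have h1 : Module.finrank (ZMod 2) W ≤ M.dim := by
    simpa using Submodule.finrank_le W
  refine le_trans (Nat.sInf_le (m := M.dim - Module.finrank (ZMod 2) W) ⟨W, by omega, ?_⟩) (by omega)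
  rw [Set.disjoint_left]
  rintro x ⟨hx, -⟩
  exact hW x hx
end
section
variable {V : Type*} [AddCommGroup V] [Module (ZMod 2) V]

/-- Every plane sum of `f` vanishes. -/
def PlaneEven (f : V → ZMod 2) : Prop := ∀ x y z,
  f x + f y + f z + f (x + y) + f (x + z) + f (y + z) + f (x + y + z) = 0

open Classical in
theorem zq (f : V → ZMod 2) (h0 : f 0 = 0) (h : PlaneEven f) :
    ∃ Q : QuadraticForm (ZMod 2) V, ∀ x, Q x = f x := by
  have hadd : ∀ a b c d e g k : ZMod 2, a + b + c + d + e + g + k = 0 → 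
    k - d - c = (e - a - c) + (g - b - c) := by decide
  refine ⟨QuadraticMap.ofPolar f ?_ ?_ ?_, fun x => rfl⟩
  · intro a x
    rcases zmod2_cases a with rfl | rfl <;> simp [h0]
  · intro x y z
    exact hadd _ _ _ _ _ _ _ (h x y z)
  · intro a x y
    rcases zmod2_cases a with rfl | rfl <;> simp [h0, QuadraticMap.polar]

theorem quad_main [Module.Finite (ZMod 2) V] (f : V → ZMod 2) (h0 : f 0 = 0) (h : PlaneEven f)
    (d : ℕ) (n : (Fin d → ZMod 2) → ZMod 2) (hn0 : n 0 = 0) (hn : PlaneEven n) :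
    (∃ φ : (Fin d → ZMod 2) →ₗ[ZMod 2] V, Function.Injective φ ∧ ∀ x, f (φ x) = n x) ∨
    ∃ W : Submodule (ZMod 2) V, (∀ x ∈ W, f x = 0) ∧
      Module.finrank (ZMod 2) V ≤ Module.finrank (ZMod 2) W + (d + 2) := by
  obtain ⟨Q, hQ⟩ := zq f h0 h
  have hpol : ∀ x y, f (x + y) = f x + f y + QuadraticMap.polarBilin Q x y := by
    intro x y
    simp [QuadraticMap.polarBilin_apply_apply, QuadraticMap.polar, hQ]
  set B := QuadraticMap.polarBilin Q with hB
  have hsymm : ∀ x y, B x y = B y x := by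
    intro x y; simp [hB, QuadraticMap.polar, add_comm]; ring
  have : Finite V := Module.finite_of_finite (ZMod 2)
  obtain ⟨W, hW, hmax⟩ : ∃ W : Submodule (ZMod 2) V, (∀ x ∈ W, f x = 0) ∧
      ∀ W' : Submodule (ZMod 2) V, (∀ x ∈ W', f x = 0) → W ≤ W' → W' ≤ W := by
    have hfin : ({W : Submodule (ZMod 2) V | ∀ x ∈ W, f x = 0}).Finite := Set.toFinite _
    obtain ⟨W, hW⟩ := hfin.exists_maximal ⟨⊥, by simp [h0]⟩
    exact ⟨W, hW.prop, fun W' h1 h2 => hW.le_of_ge h1 h2⟩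
  have hWW : ∀ x ∈ W, ∀ y ∈ W, B x y = 0 := by
    intro x hx y hy
    have := hpol x y
    rw [hW _ (W.add_mem hx hy), hW x hx, hW y hy] at this
    simpa using this.symm
  -- the map to the dual
  let β : V →ₗ[ZMod 2] Module.Dual (ZMod 2) W := (Submodule.dualRestrict W).comp B
  have hβ : ∀ x (w : W), β x w = B x w := fun x w => rfl
  by_cases hr : d ≤ Module.finrank (ZMod 2) (LinearMap.range β)
  · left
    obtain ⟨F, hF⟩ : ∃ F : (Fin d → ZMod 2) →ₗ[ZMod 2] V, Function.Injective (β.comp F) := by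
      obtain ⟨g, hg⟩ := (finrank_le_iff_exists_linearMap (R := ZMod 2)
        (M := Fin d → ZMod 2) (M' := LinearMap.range β)).1 (by simpa using hr)
      have : Module.Projective (ZMod 2) (LinearMap.range β) :=
        Module.Projective.of_basis (Module.finBasis (ZMod 2) (LinearMap.range β))
      obtain ⟨s, hs⟩ := LinearMap.exists_rightInverse_of_surjective β.rangeRestrict
        (LinearMap.range_rangeRestrict _)
      refine ⟨s.comp g, ?_⟩
      have : β.comp (s.comp g) = (LinearMap.range β).subtype.comp g := by
        ext1 x
        have := LinearMap.congr_fun hs (g (Pi.single x 1))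
        ext y
        have := congrArg Subtype.val this
        simp at this
        simp [this]
      rw [this]
      exact (Submodule.injective_subtype _).comp hg
    let s : W →ₗ[ZMod 2] Module.Dual (ZMod 2) (Fin d → ZMod 2) :=
      (β.comp F).dualMap.comp (Module.Dual.eval (ZMod 2) W)
    have hs : Function.Surjective s := by
      have h1 : Function.Surjective (β.comp F).dualMap :=
        LinearMap.dualMap_surjective_of_injective hF
      have h2 : Function.Surjective (Module.Dual.eval (ZMod 2) W) :=
        (Module.evalEquiv (ZMod 2) W).surjective
      exact h1.comp h2
    obtain ⟨r, hr⟩ := LinearMap.exists_rightInverse_of_surjective s (LinearMap.range_eq_top.2 hs)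
    obtain ⟨Q', hQ'⟩ := zq n hn0 hn
    obtain ⟨b, hb⟩ := LinearMap.BilinMap.toQuadraticMap_surjective (Q' - Q.comp F)
    have hb' : ∀ x, b x x = n x - f (F x) := by
      intro x
      have := congrArg (fun q => q x) hb
      simpa [hQ, hQ'] using this
    refine ⟨F + W.subtype.comp (r.comp b), ?_, ?_⟩
    · rw [injective_iff_map_eq_zero]
      intro x hx
      apply (injective_iff_map_eq_zero _).1 hF
      ext w
      have h1 := congrArg (fun v => β v w) hx
      simp only [LinearMap.add_apply, map_add, LinearMap.comp_apply, Submodule.subtype_apply,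
        map_zero, LinearMap.zero_apply] at h1 ⊢
      rw [hβ (r (b x) : V), hWW _ (r (b x)).2 _ w.2, add_zero] at h1
      exact h1
    · intro x
      simp only [LinearMap.add_apply, LinearMap.comp_apply, Submodule.subtype_apply]
      rw [hpol, hW _ (r (b x)).2]
      have h1 := LinearMap.congr_fun (LinearMap.congr_fun hr (b x)) x
      have h2 : s (r (b x)) x = B (F x) (r (b x)) := rfl
      rw [← h2]
      have h3 : s (r (b x)) x = b x x := h1
      rw [h3, hb']
      ring
  · right
    refine ⟨W, hW, ?_⟩
    have hrk := LinearMap.finrank_range_add_finrank_ker β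
    set K := LinearMap.ker β with hK
    have hKm : ∀ y, y ∈ K → ∀ w ∈ W, B w y = 0 := by
      intro y hy w hw
      rw [hsymm]
      exact LinearMap.congr_fun (LinearMap.mem_ker.1 hy) ⟨w, hw⟩
    have hone : ∀ y ∈ K, y ∉ W → f y = 1 := by
      intro y hy hyW
      rcases zmod2_cases (f y) with h1 | h1
      · exfalso
        apply hyW
        refine hmax (W ⊔ Submodule.span (ZMod 2) {y}) ?_ le_sup_left
          ((le_sup_right : _ ≤ W ⊔ _) (Submodule.mem_span_singleton_self y))
        intro x hx
        obtain ⟨w, hw, v, hv, rfl⟩ := Submodule.mem_sup.1 hx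
        obtain ⟨t, rfl⟩ := Submodule.mem_span_singleton.1 hv
        rcases zmod2_cases t with rfl | rfl
        · simpa using hW w hw
        · rw [one_smul, hpol, hW w hw, h1, hKm y hy w hw]; simp
      · exact h1
    suffices Module.finrank (ZMod 2) K ≤ Module.finrank (ZMod 2) W + 2 by omega
    by_contra hlt
    push Not at hlt
    have step : ∀ S : Submodule (ZMod 2) V, Module.finrank (ZMod 2) S < Module.finrank (ZMod 2) K →
        ∃ a ∈ K, a ∉ S := by
      intro S hS
      by_contra hcon
      push Not at hcon
      have := Submodule.finrank_mono (show K ≤ S from hcon)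
      omega
    have stepr : ∀ (S : Submodule (ZMod 2) V) (a : V),
        Module.finrank (ZMod 2) (S ⊔ Submodule.span (ZMod 2) {a} : Submodule (ZMod 2) V) ≤
          Module.finrank (ZMod 2) S + 1 := by
      intro S a
      have h1 := Submodule.finrank_add_le_finrank_add_finrank S (Submodule.span (ZMod 2) {a})
      have h2 := finrank_span_le_card (R := ZMod 2) ({a} : Set V)
      simp at h2
      omega
    obtain ⟨a, haK, haW⟩ := step W (by omega)
    set W1 := W ⊔ Submodule.span (ZMod 2) {a} with hW1
    have hr1 : _ ≤ _ := stepr W a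
    rw [← hW1] at hr1
    obtain ⟨b, hbK, hbW⟩ := step W1 (by omega)
    set W2 := W1 ⊔ Submodule.span (ZMod 2) {b} with hW2
    have hr2 : _ ≤ _ := stepr W1 b
    rw [← hW2] at hr2
    obtain ⟨c, hcK, hcW⟩ := step W2 (by omega)
    have l1 : W ≤ W1 := le_sup_left
    have l2 : W1 ≤ W2 := le_sup_left
    have ha1 : a ∈ W1 := (le_sup_right : _ ≤ W ⊔ _) (Submodule.mem_span_singleton_self a)
    have hb2 : b ∈ W2 := (le_sup_right : _ ≤ W1 ⊔ _) (Submodule.mem_span_singleton_self b)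
    have e1 := hone a haK haW
    have e2 := hone b hbK (fun h => hbW (l1 h))
    have e3 := hone c hcK (fun h => hcW (l2 (l1 h)))
    have e4 := hone (a + b) (K.add_mem haK hbK)
      (fun h => hbW ((W1.add_mem_iff_right ha1).1 (l1 h)))
    have e5 := hone (a + c) (K.add_mem haK hcK)
      (fun h => hcW ((W2.add_mem_iff_right (l2 ha1)).1 (l2 (l1 h))))
    have e6 := hone (b + c) (K.add_mem hbK hcK)
      (fun h => hcW ((W2.add_mem_iff_right hb2).1 (l2 (l1 h))))
    have e7 := hone (a + b + c) (K.add_mem (K.add_mem haK hbK) hcK)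
      (fun h => hcW ((W2.add_mem_iff_right (W2.add_mem (l2 ha1) hb2)).1 (l2 (l1 h))))
    have := h a b c
    rw [e1, e2, e3, e4, e5, e6, e7] at this
    revert this
    decide
end
section
variable {V : Type*} [AddCommGroup V] [Module (ZMod 2) V]

/-- Indicator function with values in `ZMod 2`. -/
noncomputable def ind (E : Set V) (x : V) : ZMod 2 := by
  classical exact if x ∈ E then 1 else 0

theorem ind_one {E : Set V} {x : V} (h : x ∈ E) : ind E x = 1 := by
  simp [ind, h]

theorem ind_zero {E : Set V} {x : V} (h : x ∉ E) : ind E x = 0 := by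
  simp [ind, h]

theorem ind_eq_zero {E : Set V} {x : V} : ind E x = 0 ↔ x ∉ E := by
  by_cases h : x ∈ E <;> simp [ind, h]

/-- Exactly one of `y`, `x + y` lies in `E`. -/
def TyOne (E : Set V) (x y : V) : Prop := y ∈ E ↔ x + y ∉ E

theorem tyOne_shift {E : Set V} {x y : V} : TyOne E x (x + y) ↔ TyOne E x y := by
  unfold TyOne; rw [c2']; tauto

theorem tyOne_add {E : Set V} (h0 : (0 : V) ∉ E) (hc : ClawFree E) (h5 : FiveFree E) {x : V}
    (hx : x ∈ E) {y z : V} (hy : TyOne E x y) (hz : TyOne E x z) : TyOne E x (y + z) := by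
  have aux : ∀ y z, y ∈ E → z ∈ E → TyOne E x y → TyOne E x z → TyOne E x (y + z) := by
    intro y z hyE hzE hy hz
    have hy' : x + y ∉ E := hy.1 hyE
    have hz' : x + z ∉ E := hz.1 hzE
    by_cases e1 : y = z
    · subst e1; rw [c2]; simp [TyOne, h0, hx]
    by_cases e2 : x = y
    · subst e2; rw [tyOne_shift]; exact hz
    by_cases e3 : x = z
    · subst e3; rw [add_comm, tyOne_shift]; exact hy
    by_contra hn
    by_cases h1 : y + z ∈ E
    · have h2 : x + (y + z) ∈ E := by
        by_contra h2; exact hn ⟨fun _ => h2, fun _ => h1⟩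
      have e : x + y + (x + z) = y + z := by
        simp [add_assoc, add_left_comm, add_comm, c2, c2']
      refine h5 (x + y) (x + z) x hy' hz' ?_ hx ?_ ?_ ?_
      · rwa [e]
      · rwa [c2']
      · rwa [c2']
      · rwa [e]
    · have h2 : x + (y + z) ∉ E := by
        intro h2; exact hn ⟨fun h => absurd h h1, fun h => absurd h2 h⟩
      exact hc x y z hx hyE hzE e2 e3 e1 hy' hz' h1 (by rwa [add_assoc])
  by_cases a : y ∈ E
  · by_cases b : z ∈ E
    · exact aux _ _ a b hy hz
    · have b' : x + z ∈ E := by by_contra h; exact b (hz.2 h)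
      have := aux y (x + z) a b' hy (tyOne_shift.2 hz)
      rwa [add_left_comm, tyOne_shift] at this
  · have a' : x + y ∈ E := by by_contra h; exact a (hy.2 h)
    by_cases b : z ∈ E
    · have := aux (x + y) z a' b (tyOne_shift.2 hy) hz
      rwa [add_assoc, tyOne_shift] at this
    · have b' : x + z ∈ E := by by_contra h; exact b (hz.2 h)
      have := aux (x + y) (x + z) a' b' (tyOne_shift.2 hy) (tyOne_shift.2 hz)
      rwa [add_assoc, tyOne_shift, add_left_comm, tyOne_shift] at this

theorem tyOne_two {E : Set V} (hf : FanoFree E) (h5 : FiveFree E) {x : V}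
    (hx : x ∈ E) {a b : V} (ha : a ∈ E) (ha' : x + a ∈ E) (hb : b ∈ E) (hb' : x + b ∈ E) :
    TyOne E x (a + b) := by
  by_contra hn
  by_cases h1 : a + b ∈ E
  · have h2 : x + (a + b) ∈ E := by
      by_contra h2; exact hn ⟨fun _ => h2, fun _ => h1⟩
    exact hf x a b hx ha hb ha' hb' h1 (by rwa [add_assoc])
  · have h2 : x + (a + b) ∉ E := by
      intro h2; exact hn ⟨fun h => absurd h h1, fun h => absurd h2 h⟩
    have e : a + b + (x + (a + b)) = x := by
      simp [add_assoc, add_left_comm, add_comm, c2, c2']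
    refine h5 (a + b) (x + (a + b)) a h1 h2 (by rwa [e]) ha (by rwa [c2']) ?_ ?_
    · rwa [add_left_comm, c2']
    · rw [e, add_comm]; exact ha'

theorem five_free_even {E : Set V} (h0 : (0 : V) ∉ E) (hc : ClawFree E) (hf : FanoFree E)
    (h5 : FiveFree E) {x y z : V} (hx : x ∈ E) (hy : y ∈ Submodule.span (ZMod 2) E)
    (hz : z ∈ Submodule.span (ZMod 2) E) :
    ind E x + ind E y + ind E z + ind E (x + y) + ind E (x + z) + ind E (y + z)
      + ind E (x + y + z) = 0 := by
  have hadd : ∀ {y z}, TyOne E x y → TyOne E x z → TyOne E x (y + z) :=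
    fun h1 h2 => tyOne_add h0 hc h5 hx h1 h2
  have hzero : TyOne E x 0 := by simp [TyOne, h0, hx]
  have hcov : ∃ a, ∀ y ∈ Submodule.span (ZMod 2) E, TyOne E x y ∨ TyOne E x (a + y) := by
    obtain ⟨a, ha⟩ : ∃ a, ∀ y ∈ E, TyOne E x y ∨ TyOne E x (a + y) := by
      by_cases hT : ∃ a ∈ E, x + a ∈ E
      · obtain ⟨a, ha, ha'⟩ := hT
        refine ⟨a, fun y hy => ?_⟩
        by_cases h : x + y ∈ E
        · exact Or.inr (tyOne_two hf h5 hx ha ha' hy h)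
        · exact Or.inl ⟨fun _ => h, fun _ => hy⟩
      · push Not at hT
        exact ⟨0, fun y hy => Or.inl ⟨fun _ => hT y hy, fun _ => hy⟩⟩
    refine ⟨a, fun y hy => ?_⟩
    induction hy using Submodule.span_induction with
    | mem y hy => exact ha y hy
    | zero => exact Or.inl hzero
    | add y z _ _ h1 h2 =>
      rcases h1 with h1 | h1 <;> rcases h2 with h2 | h2
      · exact Or.inl (hadd h1 h2)
      · right; have := hadd h1 h2; rwa [add_left_comm] at this
      · right; have := hadd h1 h2; rwa [add_assoc] at this
      · left
        have := hadd h1 h2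
        rwa [add_assoc, add_left_comm y, c2'] at this
    | smul t y _ h1 =>
      rcases zmod2_cases t with rfl | rfl
      · left; rw [zero_smul]; exact hzero
      · rwa [one_smul]
  obtain ⟨a, ha⟩ := hcov
  have k1 : TyOne E x y → TyOne E x z → TyOne E x (y + z) := hadd
  have k2 : TyOne E x y → TyOne E x (y + z) → TyOne E x z := fun h1 h2 => by
    have := hadd h1 h2; rwa [c2'] at this
  have k3 : TyOne E x z → TyOne E x (y + z) → TyOne E x y := fun h1 h2 => by
    have := hadd h1 h2; rwa [add_left_comm, c2, add_zero] at this
  have k4 : TyOne E x y ∨ TyOne E x z ∨ TyOne E x (y + z) := by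
    rcases ha y hy with h1 | h1
    · exact Or.inl h1
    rcases ha z hz with h2 | h2
    · exact Or.inr (Or.inl h2)
    right; right
    have := hadd h1 h2
    rwa [add_assoc, add_left_comm y, c2'] at this
  rw [add_assoc x y z]
  unfold TyOne at k1 k2 k3 k4
  have h1 : (1 + 1 : ZMod 2) = 0 := by decide
  rw [ind_one hx]
  by_cases b1 : y ∈ E <;> by_cases b2 : z ∈ E <;> by_cases b3 : x + y ∈ E <;>
    by_cases b4 : x + z ∈ E <;> by_cases b5 : y + z ∈ E <;> by_cases b6 : x + (y + z) ∈ E <;>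
    simp only [b1, b2, b3, b4, b5, b6, not_true_eq_false, not_false_eq_true, iff_true, iff_false,
      true_or, or_true, or_false, false_or, forall_true_left, forall_false, imp_self, ind, if_true,
      if_false] at k1 k2 k3 k4 ⊢ <;> first | decide | tauto

theorem five_free_planeEven {E : Set V} (h0 : (0 : V) ∉ E) (hc : ClawFree E) (hf : FanoFree E)
    (h5 : FiveFree E) :
    PlaneEven (fun x : Submodule.span (ZMod 2) E => ind E (x : V)) := by
  rintro ⟨x, hx⟩ ⟨y, hy⟩ ⟨z, hz⟩
  simp only [Submodule.coe_add]
  have hS : ∀ {x y}, x ∈ Submodule.span (ZMod 2) E → y ∈ Submodule.span (ZMod 2) E →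
    x + y ∈ Submodule.span (ZMod 2) E := fun h1 h2 => Submodule.add_mem _ h1 h2
  have key := fun {x y z : V} => five_free_even (x := x) (y := y) (z := z) h0 hc hf h5
  by_cases b1 : x ∈ E
  · exact key b1 hy hz
  by_cases b2 : y ∈ E
  · have := key b2 hx hz
    simp only [add_assoc, add_left_comm, add_comm] at this ⊢; exact this
  by_cases b3 : z ∈ E
  · have := key b3 hx hy
    simp only [add_assoc, add_left_comm, add_comm] at this ⊢; exact this
  by_cases b4 : x + y ∈ E
  · have := key b4 hy hz
    simp only [add_assoc, add_left_comm, add_comm, c2, c2', add_zero] at this ⊢; exact this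
  by_cases b5 : x + z ∈ E
  · have := key b5 hy hz
    simp only [add_assoc, add_left_comm, add_comm, c2, c2', add_zero] at this ⊢; exact this
  by_cases b6 : y + z ∈ E
  · have := key b6 hx hz
    simp only [add_assoc, add_left_comm, add_comm, c2, c2', add_zero] at this ⊢; exact this
  by_cases b7 : x + y + z ∈ E
  · have := key b7 hy hz
    simp only [add_assoc, add_left_comm, add_comm, c2, c2', add_zero] at this ⊢; exact this
  simp [ind, b1, b2, b3, b4, b5, b6, b7]
end
section
variable {V : Type*} [AddCommGroup V] [Module (ZMod 2) V]

/-- The coset of `{0, u, v, u + v}` through `z` lies in `E`. -/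
def FullCoset (E : Set V) (u v z : V) : Prop :=
  z ∈ E ∧ u + z ∈ E ∧ v + z ∈ E ∧ u + (v + z) ∈ E

theorem full_add {E : Set V} (h0 : (0 : V) ∉ E) (hc : ClawFree E) (hf : FanoFree E) {u v : V}
    (hu : u ∉ E) (hv : v ∉ E) (hw : u + v ∈ E) {q z : V} (hq : FullCoset E u v q) (hz : z ∈ E)
    (hzn : ¬ FullCoset E u v z) : FullCoset E u v (q + z) := by
  obtain ⟨q0, q1, q2, q3⟩ := hq
  have hu0 : u ≠ 0 := by rintro rfl; rw [zero_add] at hw; exact hv hw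
  have hv0 : v ≠ 0 := by rintro rfl; rw [add_zero] at hw; exact hu hw
  by_cases hzw : z = u + v
  · subst hzw
    refine ⟨?_, ?_, ?_, ?_⟩ <;>
      simp only [add_assoc, add_left_comm, add_comm, c2, c2', add_zero] at q0 q1 q2 q3 ⊢ <;>
      assumption
  have cl : ∀ t q', t ∉ E → t ≠ 0 → q' ∈ E → t + q' ∈ E → ∀ y, y ∈ E → t + y ∉ E →
      q' + y ∈ E ∨ t + (q' + y) ∈ E := by
    intro t q' ht ht0 h1 h2 y hy hty
    by_contra hcon
    push Not at hcon
    refine hc q' (t + q') y h1 h2 hy ?_ ?_ ?_ ?_ hcon.1 ?_ ?_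
    · intro h; apply ht0; simpa using h
    · rintro rfl; exact hty h2
    · rintro rfl; rw [c2'] at hty; exact hty h1
    · rw [add_left_comm, c2, add_zero]; exact ht
    · rw [add_assoc]; exact hcon.2
    · rw [add_left_comm q' t, c2, add_zero]; exact hty
  have lc : ∀ t s, t ∉ E → t ≠ 0 → s ∉ E → t + s ∈ E → ∀ y, y ∈ E → y ≠ t + s → t + y ∈ E →
      s + y ∈ E ∨ t + (s + y) ∈ E := by
    intro t s ht ht0 hs hts y hy hyn hty
    by_contra hcon
    push Not at hcon
    refine hc (t + s) y (t + y) hts hy hty hyn.symm ?_ ?_ ?_ ?_ ?_ ?_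
    · intro h; have := add_left_cancel h; subst this; exact hs hy
    · intro h; apply ht0; simpa using h.symm
    · rw [add_assoc]; exact hcon.2
    · simp only [add_assoc, add_left_comm, add_comm, c2, c2', add_zero] at hcon ⊢; exact hcon.1
    · rw [add_left_comm, c2, add_zero]; exact ht
    · simp only [add_assoc, add_left_comm, add_comm, c2, c2', add_zero]; exact hs
  have fn : ∀ q', q' ∈ E → (u + v) + q' ∈ E → ∀ y, y ∈ E → (u + v) + y ∈ E → q' + y ∈ E →
      (u + v) + (q' + y) ∈ E → False := by
    intro q' h1 h2 y h3 h4 h5 h6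
    exact hf (u + v) q' y hw h1 h3 h2 h4 h5 (by rwa [add_assoc])
  have hwq : (u + v) + q ∈ E := by rwa [add_assoc]
  have hwq' : (u + v) + (u + q) ∈ E := by
    simp only [add_assoc, add_left_comm, add_comm, c2, c2', add_zero] at q2 ⊢; exact q2
  have q3' : v + (u + q) ∈ E := by rwa [add_left_comm]
  have hvu : v + u ∈ E := by rwa [add_comm]
  -- no element of the two cosets equals `u + v`, if it lies in `E`
  have ne1 : u + z ≠ u + v := fun h => hv (by rw [← add_left_cancel h]; exact hz)
  have ne2 : v + z ≠ u + v := fun h => hu (by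
    rw [add_comm u] at h; rw [← add_left_cancel h]; exact hz)
  have ne3 : u + (v + z) ≠ u + v := fun h => h0 (by
    have := add_left_cancel h
    have h' : v + z = v + 0 := by rw [this, add_zero]
    rw [← add_left_cancel h']; exact hz)
  have nz : ∀ y, FullCoset E u v y → z ≠ y := by rintro y hy rfl; exact hzn hy
  have hfq : ∀ s, (s = q ∨ s = u + q ∨ s = v + q ∨ s = u + (v + q)) → FullCoset E u v s := by
    rintro s (rfl | rfl | rfl | rfl) <;> refine ⟨?_, ?_, ?_, ?_⟩ <;>
      (try simp only [add_assoc, add_left_comm, add_comm, c2, c2', add_zero] at q0 q1 q2 q3 ⊢) <;>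
      assumption
  have nq : ∀ s y, y = u + v → z = s → (s = q ∨ s = u + q ∨ s = v + q ∨ s = u + (v + q)) → False :=
    fun s y _ h1 h2 => nz s (hfq s h2) h1
  have mv : ∀ a b c : V, a + b = c → b = a + c := by
    rintro a b c rfl; rw [c2']
  have ne4 : q + z ≠ u + v := fun h => nz _ (hfq (u + (v + q)) (by simp)) (by
    rw [mv _ _ _ h]; simp only [add_assoc, add_left_comm, add_comm])
  have ne5 : u + (q + z) ≠ u + v := fun h => nz _ (hfq (v + q) (by simp)) (by
    rw [mv _ _ _ (add_left_cancel h)]; simp only [add_comm])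
  have ne6 : v + (q + z) ≠ u + v := fun h => nz _ (hfq (u + q) (by simp)) (by
    rw [add_comm u] at h
    rw [mv _ _ _ (add_left_cancel h)]; simp only [add_comm])
  have ne7 : u + (v + (q + z)) ≠ u + v := fun h => nz _ (hfq q (by simp)) (by
    have := mv _ _ _ (add_left_cancel h)
    rw [c2] at this
    have := mv _ _ _ this
    rwa [add_zero] at this)
  have A1 := fun y => cl u q hu hu0 q0 q1 y
  have A2 := fun y => cl u (v + q) hu hu0 q2 q3 y
  have A3 := fun y => cl v q hv hv0 q0 q2 y
  have A4 := fun y => cl v (u + q) hv hv0 q1 q3' y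
  have L1 := fun y => lc u v hu hu0 hv hw y
  have L2 := fun y => lc v u hv hv0 hu hvu y
  have F1 := fun y => fn q q0 hwq y
  have F2 := fun y => fn (u + q) q1 hwq' y
  clear cl lc fn nz hfq nq mv hc hf
  unfold FullCoset at hzn ⊢
  simp only [add_comm v u] at L2
  have a1 := A1 z
  have a2 := A2 z
  have a3 := A3 z
  have a4 := A4 z
  have b1 := A1 (u + z)
  have b2 := A2 (u + z)
  have b3 := A3 (u + z)
  have b4 := A4 (u + z)
  have c1 := A1 (v + z)
  have c2_ := A2 (v + z)
  have c3 := A3 (v + z)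
  have c4 := A4 (v + z)
  have d1 := A1 (u + (v + z))
  have d2 := A2 (u + (v + z))
  have d3 := A3 (u + (v + z))
  have d4 := A4 (u + (v + z))
  have a1' := A1 (q + z)
  have a2' := A2 (q + z)
  have a3' := A3 (q + z)
  have a4' := A4 (q + z)
  have b1' := A1 (u + (q + z))
  have b2' := A2 (u + (q + z))
  have b3' := A3 (u + (q + z))
  have b4' := A4 (u + (q + z))
  have c1' := A1 (v + (q + z))
  have ccTwo := A2 (v + (q + z))
  have c3' := A3 (v + (q + z))
  have c4' := A4 (v + (q + z))
  have d1' := A1 (u + (v + (q + z)))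
  have d2' := A2 (u + (v + (q + z)))
  have d3' := A3 (u + (v + (q + z)))
  have d4' := A4 (u + (v + (q + z)))
  have l1 := fun h => L1 z h hzw
  have l2 := fun h => L2 z h hzw
  have l3 := fun h => L1 (q + z) h ne4
  have l4 := fun h => L2 (q + z) h ne4
  have l5 := fun h => L1 (v + (q + z)) h ne6
  have l6 := fun h => L2 (u + (q + z)) h ne5
  have f1 := F1 z
  have f2 := F2 z
  have f3 := F1 (u + z)
  have f4 := F2 (u + z)
  clear A1 A2 A3 A4 L1 L2 F1 F2 ne1 ne2 ne3 ne4 ne5 ne6 ne7 hzw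
  simp only [add_assoc, add_left_comm, add_comm, c2, c2', add_zero] at *
  clear q0 q1 q2 q3 q3' hwq hwq' hu hv hw hvu h0 hu0 hv0
  by_cases t1 : u + z ∈ E <;> by_cases t2 : v + z ∈ E <;> by_cases t3 : u + (v + z) ∈ E <;>
    by_cases t4 : q + z ∈ E <;> by_cases t5 : u + (q + z) ∈ E <;>
    by_cases t6 : v + (q + z) ∈ E <;> by_cases t7 : u + (v + (q + z)) ∈ E <;>
    first | exact ⟨t4, t5, t6, t7⟩ | (exfalso; grind only)

theorem exists_codim_two [Module.Finite (ZMod 2) V] {E : Set V} (h0 : (0 : V) ∉ E)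
    (hc : ClawFree E) (hf : FanoFree E) {u v p : V}
    (hu : u ∉ E) (hv : v ∉ E) (hw : u + v ∈ E) (hp : FullCoset E u v p) :
    ∃ W : Submodule (ZMod 2) V, (∀ x ∈ W, x ∉ E) ∧
      Module.finrank (ZMod 2) V ≤ Module.finrank (ZMod 2) W + 2 := by
  have fi : ∀ q z, FullCoset E u v q → FullCoset E u v z → ¬ FullCoset E u v (q + z) := by
    rintro q z ⟨a1, -, -, a2⟩ ⟨b1, -, -, b2⟩ ⟨d1, -, -, d2⟩
    exact hf (u + v) q z hw a1 b1 (by rwa [add_assoc]) (by rwa [add_assoc]) d1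
      (by rwa [add_assoc, add_assoc])
  have fii : ∀ q z, FullCoset E u v q → z ∈ E → ¬ FullCoset E u v z → FullCoset E u v (q + z) :=
    fun q z h1 h2 h3 => full_add h0 hc hf hu hv hw h1 h2 h3
  have fiii : ∀ q r s, FullCoset E u v q → FullCoset E u v r → FullCoset E u v s →
      FullCoset E u v (q + r + s) := by
    intro q r s h1 h2 h3
    by_cases e1 : q = r
    · subst e1; rwa [c2, zero_add]
    by_cases e2 : q = s
    · subst e2; rwa [add_comm q r, add_assoc, c2, add_zero]
    by_cases e3 : r = s
    · subst e3; rwa [add_assoc, c2, add_zero]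
    by_contra hn
    refine hc q r s h1.1 h2.1 h3.1 e1 e2 e3 ?_ ?_ ?_ ?_
    · intro h
      apply hn
      rw [add_comm]; exact fii _ _ h3 h (fi _ _ h1 h2)
    · intro h
      apply hn
      rw [add_right_comm, add_comm]; exact fii _ _ h2 h (fi _ _ h1 h3)
    · intro h
      apply hn
      rw [add_assoc]; exact fii _ _ h1 h (fi _ _ h2 h3)
    · intro h
      have := fii _ _ h3 h hn
      rw [add_comm, add_assoc, c2, add_zero] at this
      exact fi _ _ h1 h2 this
  have smul_ok : ∀ (P : V → Prop), P 0 → ∀ (t : ZMod 2) x, P x → P (t • x) := by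
    intro P hP t x hx
    rcases zmod2_cases t with rfl | rfl
    · rwa [zero_smul]
    · rwa [one_smul]
  have z0 : FullCoset E u v (p + 0) := by rwa [add_zero]
  let H : Submodule (ZMod 2) V :=
    { carrier := {h | FullCoset E u v (p + h)}
      zero_mem' := z0
      add_mem' := by
        intro a b ha hb
        have := fiii _ _ _ ha hb hp
        have e : p + a + (p + b) + p = p + (a + b) := by
          simp only [add_assoc, add_left_comm, add_comm, c2, c2', add_zero]
        rw [e] at this
        exact this
      smul_mem' := fun t x hx => smul_ok (fun h => FullCoset E u v (p + h)) z0 t x hx }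
  have hH : ∀ h, h ∈ H ↔ FullCoset E u v (p + h) := fun h => Iff.rfl
  have tri : ∀ a b, a ∈ E → a ∈ H → b ∈ E → b ∈ H → a + b ∉ E := by
    intro a b ha haH hb hbH hab
    exact hf p a b hp.1 ha hb ((hH _).1 haH).1 ((hH _).1 hbH).1 hab
      (by rw [add_assoc]; exact ((hH _).1 (H.add_mem haH hbH)).1)
  have hwH : u + v ∈ H := by
    rw [hH]
    obtain ⟨q0, q1, q2, q3⟩ := hp
    refine ⟨?_, ?_, ?_, ?_⟩ <;>
      simp only [add_assoc, add_left_comm, add_comm, c2, c2', add_zero] at q0 q1 q2 q3 ⊢ <;>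
      assumption
  have z1 : u + v + 0 ∈ E ∧ (0 : V) ∈ H := ⟨by rwa [add_zero], H.zero_mem⟩
  let D : Submodule (ZMod 2) V :=
    { carrier := {d | u + v + d ∈ E ∧ d ∈ H}
      zero_mem' := z1
      add_mem' := by
        rintro a b ⟨ha, haH⟩ ⟨hb, hbH⟩
        refine ⟨?_, H.add_mem haH hbH⟩
        by_cases e1 : a = 0
        · subst e1; rwa [zero_add]
        by_cases e2 : b = 0
        · subst e2; rwa [add_zero]
        by_cases e3 : a = b
        · subst e3; rwa [c2, add_zero]
        by_contra hn
        have haH' := H.add_mem hwH haH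
        have hbH' := H.add_mem hwH hbH
        refine hc (u + v) (u + v + a) (u + v + b) hw ha hb (by simpa using e1) (by simpa using e2)
          (by simpa using e3) (tri _ _ hw hwH ha haH') (tri _ _ hw hwH hb hbH')
          (tri _ _ ha haH' hb hbH') ?_
        have e : u + v + (u + v + a) + (u + v + b) = u + v + (a + b) := by
          simp only [add_assoc, add_left_comm, add_comm, c2, c2', add_zero]
        rwa [e]
      smul_mem' := fun t x hx => smul_ok (fun d => u + v + d ∈ E ∧ d ∈ H) z1 t x hx }
  have hpH : p ∉ H := by
    rw [hH, c2]; exact fun h => h0 h.1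
  have hwD : u + v ∉ D := by
    rintro ⟨h, -⟩; rw [c2] at h; exact h0 h
  obtain ⟨h, hh1, hh2⟩ := Submodule.exists_le_ker_of_notMem hpH
  obtain ⟨g, hg1, hg2⟩ := Submodule.exists_le_ker_of_notMem hwD
  refine ⟨LinearMap.ker (g.prod h), ?_, ?_⟩
  · intro x hx hxE
    rw [LinearMap.mem_ker, LinearMap.prod_apply] at hx
    have hgx : g x = 0 := congrArg Prod.fst hx
    have hhx : h x = 0 := congrArg Prod.snd hx
    by_cases hF : FullCoset E u v x
    · have : p + x ∈ H := by rw [hH, c2']; exact hF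
      have := LinearMap.mem_ker.1 (hh2 this)
      rw [map_add, hhx, add_zero] at this
      exact hh1 this
    · have hxH : x ∈ H := fii _ _ hp hxE hF
      have : u + v + x ∈ D := ⟨by rwa [c2'], H.add_mem hwH hxH⟩
      have := LinearMap.mem_ker.1 (hg2 this)
      rw [map_add, hgx, add_zero] at this
      exact hg1 this
  · have h1 := LinearMap.finrank_range_add_finrank_ker (g.prod h)
    have h2 := Submodule.finrank_le (LinearMap.range (g.prod h))
    have h3 : Module.finrank (ZMod 2) (ZMod 2 × ZMod 2) = 2 := by simp
    omega
end
section
variable {V : Type*} [AddCommGroup V] [Module (ZMod 2) V]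

theorem ncard_eq_sum_ind [Finite V] (E : Set V) (S : Finset V) :
    (((E ∩ (S : Set V)).ncard : ℕ) : ZMod 2) = ∑ x ∈ S, ind E x := by
  classical
  have : E ∩ (S : Set V) = ((S.filter (fun x => x ∈ E) : Finset V) : Set V) := by
    ext x; simp [and_comm]
  rw [this, Set.ncard_coe_finset, Finset.card_filter]
  push_cast
  exact Finset.sum_congr rfl (fun x _ => by by_cases h : x ∈ E <;> simp [ind, h])

theorem planeEven_of_memE (N : BinMatroid) (hN : N.MemE 3) : PlaneEven (ind N.E) := by
  classical
  intro x y z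
  have i0 : ind N.E 0 = 0 := ind_zero N.zero_not_mem
  by_cases e1 : x = 0
  · subst e1; simp only [zero_add, i0]; grind
  by_cases e2 : y = 0
  · subst e2; simp only [zero_add, add_zero, i0]; grind
  by_cases e3 : z = 0
  · subst e3; simp only [add_zero, i0]; grind
  by_cases e4 : x = y
  · subst e4; simp only [c2, zero_add, i0]; grind
  by_cases e5 : x = z
  · subst e5; simp only [c2, add_comm, c2', i0, add_zero]; grind
  by_cases e6 : y = z
  · subst e6; simp only [add_assoc, c2, add_zero]; grind
  by_cases e7 : x + y = z
  · subst e7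
    rw [c2, c2', add_left_comm y, c2, add_zero, i0]; grind
  have e : ∀ x y : Fin N.dim → ZMod 2, x + y = 0 → x = y := fun x y h => by
    have := c2' x y; rw [h, add_zero] at this; exact this
  have hinj := map3_inj x y z e1 e2 e3 (fun h => e4 (e _ _ h)) (fun h => e5 (e _ _ h))
    (fun h => e6 (e _ _ h)) (fun h => e7 (e _ _ h))
  have h3 : Module.finrank (ZMod 2) (LinearMap.range (map3 x y z)) = 3 := by
    rw [LinearMap.finrank_range_of_inj hinj]; simp
  have hev := hN _ h3.ge
  have hS : N.E ∩ ((LinearMap.range (map3 x y z) : Set (Fin N.dim → ZMod 2)) \ {0}) =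
      N.E ∩ ((Finset.univ.image (map3 x y z) : Finset (Fin N.dim → ZMod 2)) :
        Set (Fin N.dim → ZMod 2)) := by
    ext t
    have : t ∈ N.E → t ≠ 0 := by rintro ht rfl; exact N.zero_not_mem ht
    simp only [Set.mem_inter_iff, Set.mem_sdiff, Set.mem_singleton_iff, Finset.coe_image,
      Finset.coe_univ, Set.image_univ, LinearMap.coe_range]
    tauto
  rw [hS] at hev
  have hz := (ZMod.natCast_eq_zero_iff_even).2 hev
  rw [ncard_eq_sum_ind, Finset.sum_image (fun a _ b _ h => hinj h)] at hz
  have hu : (Finset.univ : Finset (Fin 3 → ZMod 2)) = {![0,0,0], ![1,0,0], ![0,1,0], ![0,0,1],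
      ![1,1,0], ![1,0,1], ![0,1,1], ![1,1,1]} := by decide
  rw [hu, Finset.sum_insert (by decide), Finset.sum_insert (by decide),
    Finset.sum_insert (by decide), Finset.sum_insert (by decide), Finset.sum_insert (by decide),
    Finset.sum_insert (by decide), Finset.sum_insert (by decide), Finset.sum_singleton] at hz
  simp only [map3_apply, Matrix.cons_val_zero, Matrix.cons_val_one, Matrix.cons_val,
    zero_smul, one_smul, zero_add, add_zero, i0] at hz
  rw [← hz]
  ring
end

/-- For every matroid `N ∈ ℰ₃`, if `M` is a simple binary matroid
containing none of `I₃`, `F₇`, or `N` as an induced restriction, then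
`χ(M) ≤ dim(N) + 4`. -/
theorem stmt1 (N : BinMatroid) (hN : N.MemE 3) (M : BinMatroid)
    (hI3 : ¬ M.HasIR I3) (hF7 : ¬ M.HasIR F7) (hNM : ¬ M.HasIR N) :
    M.critNum ≤ N.dim + 4 := by
  have hc := clawFree_of M hI3
  have hf := fanoFree_of M hF7
  have h0 := M.zero_not_mem
  by_cases h5 : FiveFree M.E
  · have hp := five_free_planeEven h0 hc hf h5
    set U := Submodule.span (ZMod 2) M.E with hU
    rcases quad_main (fun x : U => ind M.E (x : Fin M.dim → ZMod 2))
      (ind_zero (by simpa using h0)) hp N.dim (ind N.E) (ind_zero N.zero_not_mem)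
      (planeEven_of_memE N hN) with ⟨φ, hφ, h⟩ | ⟨W, hW, hd⟩
    · exfalso
      apply hNM
      refine hasIR_of M N (U.subtype ∘ₗ φ) ?_ ?_
      · exact (Subtype.val_injective).comp hφ
      · intro x
        have hx := h x
        have e1 := @ind_eq_zero _ _ _ M.E ((φ x : U) : Fin M.dim → ZMod 2)
        have e2 := @ind_eq_zero _ _ _ N.E x
        rw [hx] at e1
        exact not_iff_not.1 (e1.symm.trans e2)
    · obtain ⟨C, hC⟩ := Submodule.exists_isCompl U
      refine critNum_le M (W.map U.subtype ⊔ C) _ ?_ ?_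
      · intro x hx hxE
        obtain ⟨a, ha, c, hcC, rfl⟩ := Submodule.mem_sup.1 hx
        obtain ⟨w, hw, rfl⟩ := Submodule.mem_map.1 ha
        have hxU : U.subtype w + c ∈ U := Submodule.subset_span hxE
        have hcU : c ∈ U := (Submodule.add_mem_iff_right U w.2).1 hxU
        have hc0 : c = 0 := Submodule.disjoint_def.1 hC.disjoint c hcU hcC
        subst hc0
        rw [add_zero] at hxE
        exact ind_eq_zero.1 (hW w hw) hxE
      · have d1 := Submodule.finrank_add_eq_of_isCompl hC
        have d2 : Module.finrank (ZMod 2) (W.map U.subtype) = Module.finrank (ZMod 2) W :=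
          Submodule.finrank_map_subtype_eq U W
        have d3 := Submodule.finrank_sup_add_finrank_inf_eq (W.map U.subtype) C
        have d4 : W.map U.subtype ⊓ C = ⊥ :=
          (hC.disjoint.mono_left (Submodule.map_subtype_le U W)).eq_bot
        rw [d4, finrank_bot] at d3
        rw [Module.finrank_fin_fun] at d1
        omega
  · unfold FiveFree at h5
    push Not at h5
    obtain ⟨u, v, p, hu, hv, hw, p0, p1, p2, p3⟩ := h5
    obtain ⟨W, hW, hd⟩ := exists_codim_two h0 hc hf hu hv hw (p := p)
      ⟨p0, by rwa [add_comm], by rwa [add_comm], by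
        have e : u + (v + p) = p + (u + v) := by rw [← add_assoc, add_comm]
        rw [e]; simpa using p3⟩
    rw [Module.finrank_fin_fun] at hd
    exact critNum_le M W _ hW (by omega)
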